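/- Let F be a nonzero linear subspace of ℝⁿ, σ > 0, 0 < α < 1/2 and 0 < γ < 1 − 2α. Suppose the confidence band (L,U) satisfies inf_{f∈F} P_f(L ≤ f ≤ U) ≥ 1 − α, and suppose inf_{f∈F} P_f(W ≤ w) ≥ 1 − γ for some w ≥ 0. Then w ≥ σ·Ω_F·τ⁻¹(1 − 2α − γ); equivalently, τ( w/(σ·Ω_F) ) ≥ 1 − 2α − γ. -/

import Mathlib

open MeasureTheory ProbabilityTheory Real

noncomputable section

/-- Product Gaussian measure `N(f, σ² Iₙ)` on `ℝⁿ`. -/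
def gaussP (n : ℕ) (f : Fin n → ℝ) (σ : ℝ) : Measure (Fin n → ℝ) :=
  Measure.pi fun i => gaussianReal (f i) (Real.toNNReal (σ ^ 2))

/-- Standard normal CDF `Φ`. -/
def stdCDF (x : ℝ) : ℝ := ((gaussianReal 0 1) (Set.Iic x)).toReal

/-- Standard normal density `φ`. -/
def stdPDF (x : ℝ) : ℝ := Real.exp (-(x ^ 2) / 2) / Real.sqrt (2 * Real.pi)

/-- `τ(ε) = Φ(ε/2) - Φ(-ε/2)`. -/
def tau (ε : ℝ) : ℝ := stdCDF (ε / 2) - stdCDF (-(ε / 2))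

/-- Inverse of `τ`. -/
def tauInv (p : ℝ) : ℝ := Function.invFun tau p

/-- Standard normal quantile function `Φ⁻¹`. -/
def PhiInv (p : ℝ) : ℝ := Function.invFun stdCDF p

/-- Normalized Euclidean norm `‖v‖ = √((1/n) ∑ vᵢ²)`. -/
def norm2 (n : ℕ) (v : Fin n → ℝ) : ℝ := Real.sqrt ((∑ i, (v i) ^ 2) / n)

/-- Sup norm `‖v‖_∞ = maxᵢ |vᵢ|`. -/
def normInf (n : ℕ) (v : Fin n → ℝ) : ℝ := ⨆ i, |v i|

/-- Normalized inner product. -/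
def inner2 (n : ℕ) (u v : Fin n → ℝ) : ℝ := (∑ i, u i * v i) / n

/-- Total variation distance between two measures on `ℝⁿ`. -/
def dTV (n : ℕ) (P Q : Measure (Fin n → ℝ)) : ℝ :=
  ⨆ A : {A : Set (Fin n → ℝ) // MeasurableSet A}, |(P A).toReal - (Q A).toReal|

/-- Width of the band `(L, U)` at data `y`. -/
def width (n : ℕ) (L U : (Fin n → ℝ) → Fin n → ℝ) (y : Fin n → ℝ) : ℝ :=
  ⨆ i, (U y i - L y i)

/-- The band `(L,U)` covers `g` at data `y`. -/
def covers (n : ℕ) (L U : (Fin n → ℝ) → Fin n → ℝ) (g y : Fin n → ℝ) : Prop :=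
  ∀ i, L y i ≤ g i ∧ g i ≤ U y i

/-- `P` is the orthogonal projection onto the subspace `F` of `ℝⁿ`. -/
def IsOrthProjOn (n : ℕ) (F : Submodule ℝ (Fin n → ℝ))
    (P : (Fin n → ℝ) →ₗ[ℝ] (Fin n → ℝ)) : Prop :=
  (∀ f, P f ∈ F) ∧ (∀ f, ∀ g ∈ F, inner2 n (f - P f) g = 0)

/-- `Ω_F = max_i ‖Π_F eᵢ‖ / ‖eᵢ‖`. -/
def OmegaF (n : ℕ) (P : (Fin n → ℝ) →ₗ[ℝ] (Fin n → ℝ)) : ℝ :=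
  ⨆ i : Fin n, norm2 n (P (Pi.single i 1)) / norm2 n (Pi.single i 1)

/-- The `p`-quantile of the chi-squared distribution with `m` degrees of freedom. -/
def chiSqQuantile (m : ℕ) (p : ℝ) : ℝ :=
  sInf {t : ℝ | ENNReal.ofReal p ≤
    (Measure.pi fun _ : Fin m => gaussianReal 0 1) {z | ∑ k, (z k) ^ 2 ≤ t}}

/-- The Neyman–Pearson inequality: if `ν ≤ μ` on `H` and `μ ≤ ν` off `H`, then `H` maximizes
`μ A - ν A` over measurable `A`. -/
lemma measure_add_le_of_le_on_of_le_compl {Ω : Type*} [MeasurableSpace Ω] {μ ν : Measure Ω}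
    {H : Set Ω} (hH : MeasurableSet H)
    (hνμ : ν.restrict H ≤ μ.restrict H) (hμν : μ.restrict Hᶜ ≤ ν.restrict Hᶜ)
    {A : Set Ω} (hA : MeasurableSet A) : μ A + ν H ≤ ν A + μ H := by
  have h1 : ν (H \ A) ≤ μ (H \ A) := by
    have := hνμ (H \ A)
    rwa [Measure.restrict_eq_self _ Set.sdiff_subset,
      Measure.restrict_eq_self _ Set.sdiff_subset] at this
  have h2 : μ (A \ H) ≤ ν (A \ H) := by
    have := hμν (A \ H)
    rwa [Measure.restrict_eq_self _ fun x hx => hx.2,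
      Measure.restrict_eq_self _ fun x hx => hx.2] at this
  calc μ A + ν H
      = (μ (A ∩ H) + μ (A \ H)) + (ν (A ∩ H) + ν (H \ A)) := by
        rw [measure_inter_add_sdiff A hH, Set.inter_comm A H, measure_inter_add_sdiff H hA]
    _ ≤ (μ (A ∩ H) + ν (A \ H)) + (ν (A ∩ H) + μ (H \ A)) := by gcongr
    _ = (ν (A ∩ H) + ν (A \ H)) + (μ (A ∩ H) + μ (H \ A)) := by ring
    _ = ν A + μ H := by
        rw [measure_inter_add_sdiff A hH, Set.inter_comm A H, measure_inter_add_sdiff H hA]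

lemma pi_withDensity {ι : Type*} [Fintype ι] {Ω : ι → Type*} [∀ i, MeasurableSpace (Ω i)]
    (μ : ∀ i, Measure (Ω i)) [∀ i, IsProbabilityMeasure (μ i)] {p : ∀ i, Ω i → ENNReal}
    (hp : ∀ i, Measurable (p i)) [∀ i, SigmaFinite ((μ i).withDensity (p i))] :
    Measure.pi (fun i => (μ i).withDensity (p i)) =
      (Measure.pi μ).withDensity fun y => ∏ i, p i (y i) := by
  classical
  refine Measure.pi_eq fun s hs => ?_
  have hind : ∀ i, Measurable ((s i).indicator (p i)) := fun i => (hp i).indicator (hs i)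
  have hprod : (Set.univ.pi s).indicator (fun y => ∏ i, p i (y i)) =
      fun y => ∏ i, (s i).indicator (p i) (y i) := by
    ext y
    by_cases hy : y ∈ Set.univ.pi s
    · rw [Set.indicator_of_mem hy]
      exact Finset.prod_congr rfl fun i _ => (Set.indicator_of_mem (hy i trivial) _).symm
    · rw [Set.indicator_of_notMem hy]
      simp only [Set.mem_pi, Set.mem_univ, true_implies, not_forall] at hy
      obtain ⟨i, hi⟩ := hy
      exact (Finset.prod_eq_zero (Finset.mem_univ i) (Set.indicator_of_notMem hi _)).symm
  rw [withDensity_apply _ (MeasurableSet.univ_pi hs),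
    ← lintegral_indicator (MeasurableSet.univ_pi hs), hprod]
  refine (lintegral_prod_eq_prod_lintegral_of_indepFun Finset.univ
    (fun i (y : ∀ i, Ω i) => (s i).indicator (p i) (y i))
    (iIndepFun_pi fun i => (hind i).aemeasurable)
    fun i => (hind i).comp (measurable_pi_apply i)).trans ?_
  refine Finset.prod_congr rfl fun i _ => ?_
  rw [withDensity_apply _ (hs i), ← lintegral_indicator (hs i)]
  exact (measurePreserving_eval μ i).lintegral_comp (hind i)

lemma gaussianReal_eq_withDensity_exp (m : ℝ) {v : NNReal} (hv : v ≠ 0) :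
    gaussianReal m v = (gaussianReal 0 v).withDensity
      fun x => ENNReal.ofReal (exp ((m * x - m ^ 2 / 2) / v)) := by
  have hv' : (0 : ℝ) < v := by positivity
  rw [gaussianReal_of_var_ne_zero m hv, gaussianReal_of_var_ne_zero 0 hv,
    ← withDensity_mul _ (measurable_gaussianPDF _ _) (by fun_prop)]
  congr 1
  ext x
  rw [Pi.mul_apply, gaussianPDF, gaussianPDF, ← ENNReal.ofReal_mul (gaussianPDFReal_nonneg _ _ _),
    gaussianPDFReal, gaussianPDFReal, mul_assoc _ (exp _), ← exp_add]
  congr 3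
  field_simp
  ring

instance (n : ℕ) (f : Fin n → ℝ) (σ : ℝ) : IsProbabilityMeasure (gaussP n f σ) := by
  unfold gaussP; infer_instance

lemma gaussP_eq_withDensity (n : ℕ) (g : Fin n → ℝ) {σ : ℝ} (hσ : 0 < σ) :
    gaussP n g σ = (gaussP n 0 σ).withDensity
      fun y => ENNReal.ofReal (exp ((∑ i, g i * y i - (∑ i, g i ^ 2) / 2) / σ ^ 2)) := by
  have hv : Real.toNNReal (σ ^ 2) ≠ 0 := by simpa using hσ.ne'
  have h := fun i => gaussianReal_eq_withDensity_exp (g i) hv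
  have hs : ∀ i, SigmaFinite ((gaussianReal 0 (Real.toNNReal (σ ^ 2))).withDensity
      fun x => ENNReal.ofReal (exp ((g i * x - g i ^ 2 / 2) / Real.toNNReal (σ ^ 2)))) :=
    fun i => by rw [← h i]; infer_instance
  unfold gaussP
  simp_rw [h]
  rw [pi_withDensity _ fun i => by fun_prop]
  congr 1
  ext y
  rw [← ENNReal.ofReal_prod_of_nonneg fun i _ => (exp_pos _).le, ← exp_sum, ← Finset.sum_div,
    Finset.sum_sub_distrib, Finset.sum_div, Real.coe_toNNReal _ (sq_nonneg σ)]

lemma gaussP_map_linear (n : ℕ) (f g : Fin n → ℝ) (σ : ℝ) :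
    (gaussP n f σ).map (fun y => ∑ i, g i * y i) =
      gaussianReal (∑ i, g i * f i) (Real.toNNReal (σ ^ 2 * ∑ i, g i ^ 2)) := by
  have hm : Measurable (fun y : Fin n → ℝ => ∑ i, g i * y i) := by fun_prop
  have := Measure.isProbabilityMeasure_map (μ := gaussP n f σ) hm.aemeasurable
  refine Measure.ext_of_charFun ?_
  ext t
  rw [charFun_gaussianReal, charFun_apply_real, integral_map hm.aemeasurable (by fun_prop)]
  have h : ∀ y : Fin n → ℝ, Complex.exp (t * ((∑ i, g i * y i : ℝ) : ℂ) * Complex.I) =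
      ∏ i, Complex.exp (((t * g i : ℝ) : ℂ) * y i * Complex.I) := fun y => by
    rw [← Complex.exp_sum]; congr 1
    push_cast
    rw [Finset.mul_sum, Finset.sum_mul]
    exact Finset.sum_congr rfl fun i _ => by ring
  simp_rw [h, gaussP]
  rw [integral_fintype_prod_eq_prod
    (f := fun i x => Complex.exp (((t * g i : ℝ) : ℂ) * ((x : ℝ) : ℂ) * Complex.I))]
  simp_rw [← charFun_apply_real, charFun_gaussianReal, ← Complex.exp_sum]
  congr 1
  rw [Real.coe_toNNReal _ (by positivity), Real.coe_toNNReal _ (by positivity)]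
  push_cast
  rw [Finset.sum_sub_distrib]
  simp only [Finset.mul_sum, Finset.sum_mul, Finset.sum_div]
  congr 1 <;> exact Finset.sum_congr rfl fun i _ => by ring

lemma gaussianReal_real_Iic (m c : ℝ) {s : ℝ} (hs : 0 < s) :
    (gaussianReal m (Real.toNNReal (s ^ 2))).real (Set.Iic c) = stdCDF ((c - m) / s) := by
  have h : gaussianReal m (Real.toNNReal (s ^ 2)) =
      (gaussianReal 0 1).map (fun x => m + s * x) := by
    have : (fun x : ℝ => m + s * x) = (fun x => m + x) ∘ fun x => s * x := rfl
    rw [this, ← Measure.map_map (by fun_prop) (by fun_prop), gaussianReal_map_const_mul,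
      gaussianReal_map_const_add]
    congr 1
    · simp
    · ext; simp [sq_nonneg]
  rw [h, Measure.real, Measure.map_apply (by fun_prop) measurableSet_Iic, stdCDF]
  congr 2
  ext x
  simp [le_div_iff₀ hs, le_sub_iff_add_le', mul_comm]

lemma stdCDF_strictMono : StrictMono stdCDF := fun x y hxy => by
  have hv : (1 : NNReal) ≠ 0 := one_ne_zero
  have hpos : 0 < (gaussianReal 0 1).real (Set.Ioc x y) := by
    refine ENNReal.toReal_pos (fun h0 => ?_) (measure_ne_top _ _)
    have := gaussianReal_absolutelyContinuous' 0 hv h0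
    simp [Real.volume_Ioc] at this
    linarith
  have := measureReal_union (μ := gaussianReal 0 1) (s₁ := Set.Iic x) (s₂ := Set.Ioc x y)
    (Set.disjoint_left.2 fun z hz hz' => not_lt.2 hz hz'.1) measurableSet_Ioc
  rw [Set.Iic_union_Ioc_eq_Iic hxy.le] at this
  simp only [stdCDF, ← measureReal_def]
  linarith

lemma stdCDF_continuous : Continuous stdCDF := by
  have := nullSingletonClass_gaussianReal (μ := 0) (v := 1) one_ne_zero
  have hcdf : stdCDF = cdf (gaussianReal 0 1) := by
    ext x
    rw [cdf_eq_real]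
    rfl
  rw [hcdf, continuous_iff_continuousAt]
  intro a
  have h0 : (cdf (gaussianReal 0 1)).measure {a} = 0 := by
    rw [measure_cdf]
    exact measure_singleton a
  rw [StieltjesFunction.measure_singleton, ENNReal.ofReal_eq_zero] at h0
  refine continuousAt_iff_continuous_left_right.2 ⟨?_, (cdf _).right_continuous a⟩
  rw [← continuousWithinAt_Iio_iff_Iic, (cdf _).mono.continuousWithinAt_Iio_iff_leftLim_eq]
  exact le_antisymm ((cdf _).mono.leftLim_le le_rfl) (by linarith)

lemma tau_strictMono : StrictMono tau := fun x y hxy => by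
  have h1 := stdCDF_strictMono (show x / 2 < y / 2 by linarith)
  have h2 := stdCDF_strictMono (show -(y / 2) < -(x / 2) by linarith)
  unfold tau
  linarith

lemma tau_continuous : Continuous tau :=
  (stdCDF_continuous.comp (by fun_prop)).sub (stdCDF_continuous.comp (by fun_prop))

lemma tau_tauInv {p x : ℝ} (hp : 0 ≤ p) (hx : 0 ≤ x) (hpx : p ≤ tau x) : tau (tauInv p) = p := by
  have h0 : tau 0 = 0 := by simp [tau]
  obtain ⟨y, -, hy⟩ := intermediate_value_Icc hx tau_continuous.continuousOn
    (show p ∈ Set.Icc (tau 0) (tau x) from ⟨h0.trans_le hp, hpx⟩)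
  exact Function.invFun_eq ⟨y, hy⟩

lemma gaussP_real_halfSpace (n : ℕ) (f g : Fin n → ℝ) {σ : ℝ} (hσ : 0 < σ)
    (hg : 0 < ∑ i, g i ^ 2) (c : ℝ) :
    (gaussP n f σ).real {y | ∑ i, g i * y i ≤ c} =
      stdCDF ((c - ∑ i, g i * f i) / (σ * √(∑ i, g i ^ 2))) := by
  have hm : Measurable (fun y : Fin n → ℝ => ∑ i, g i * y i) := by fun_prop
  rw [← gaussianReal_real_Iic _ _ (mul_pos hσ (Real.sqrt_pos.2 hg)), mul_pow, Real.sq_sqrt hg.le,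
    ← gaussP_map_linear, measureReal_def, measureReal_def, Measure.map_apply hm measurableSet_Iic]
  rfl

/-- The total variation bound between two Gaussian shifts. -/
lemma gaussP_real_sub_le_tau (n : ℕ) (g : Fin n → ℝ) {σ : ℝ} (hσ : 0 < σ)
    (hg : 0 < ∑ i, g i ^ 2) {A : Set (Fin n → ℝ)} (hA : MeasurableSet A) :
    (gaussP n 0 σ).real A - (gaussP n g σ).real A ≤ tau (√(∑ i, g i ^ 2) / σ) := by
  set H : Set (Fin n → ℝ) := {y | ∑ i, g i * y i ≤ (∑ i, g i ^ 2) / 2} with hHdef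
  have hH : MeasurableSet H := measurableSet_le (by fun_prop) (by fun_prop)
  have hle : gaussP n 0 σ A + gaussP n g σ H ≤ gaussP n g σ A + gaussP n 0 σ H := by
    refine measure_add_le_of_le_on_of_le_compl hH ?_ ?_ hA
    · rw [gaussP_eq_withDensity n g hσ, restrict_withDensity hH]
      conv_rhs => rw [← withDensity_one (μ := (gaussP n 0 σ).restrict H)]
      refine withDensity_mono ((ae_restrict_iff' hH).2 (ae_of_all _ fun y hy => ?_))
      rw [Pi.one_apply, ENNReal.ofReal_le_one, exp_le_one_iff]
      exact div_nonpos_of_nonpos_of_nonneg (sub_nonpos.2 hy) (sq_nonneg σ)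
    · rw [gaussP_eq_withDensity n g hσ, restrict_withDensity hH.compl]
      conv_lhs => rw [← withDensity_one (μ := (gaussP n 0 σ).restrict Hᶜ)]
      refine withDensity_mono ((ae_restrict_iff' hH.compl).2 (ae_of_all _ fun y hy => ?_))
      rw [Pi.one_apply, ENNReal.one_le_ofReal, one_le_exp_iff]
      exact div_nonneg (sub_nonneg.2 (le_of_not_ge fun h => hy h)) (sq_nonneg σ)
  have hreal : (gaussP n 0 σ).real A + (gaussP n g σ).real H ≤
      (gaussP n g σ).real A + (gaussP n 0 σ).real H := by
    simp only [measureReal_def]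
    rw [← ENNReal.toReal_add (by finiteness) (by finiteness),
      ← ENNReal.toReal_add (by finiteness) (by finiteness)]
    exact ENNReal.toReal_mono (by finiteness) hle
  rw [hHdef, gaussP_real_halfSpace n g g hσ hg, gaussP_real_halfSpace n 0 g hσ hg] at hreal
  have hr := Real.sqrt_pos.2 hg
  have hsq := Real.sq_sqrt hg.le
  have e1 : ((∑ i, g i ^ 2) / 2 - ∑ i, g i * g i) / (σ * √(∑ i, g i ^ 2)) =
      -(√(∑ i, g i ^ 2) / σ / 2) := by
    simp only [← pow_two]
    field_simp
    linarith
  have e2 : ((∑ i, g i ^ 2) / 2 - ∑ i, g i * (0 : Fin n → ℝ) i) / (σ * √(∑ i, g i ^ 2)) =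
      √(∑ i, g i ^ 2) / σ / 2 := by
    simp only [Pi.zero_apply, mul_zero, Finset.sum_const_zero, sub_zero]
    field_simp
    linarith
  rw [e1, e2] at hreal
  unfold tau
  linarith

lemma measurableSet_covers {n : ℕ} {L U : (Fin n → ℝ) → Fin n → ℝ}
    (hL : Measurable L) (hU : Measurable U) (g : Fin n → ℝ) :
    MeasurableSet {y | covers n L U g y} := by
  simp only [covers, Set.ofPred_forall, Set.ofPred_and]
  exact MeasurableSet.iInter fun i =>
    (measurableSet_le (by fun_prop) measurable_const).inter
      (measurableSet_le measurable_const (by fun_prop))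

lemma measurableSet_width_le {n : ℕ} {L U : (Fin n → ℝ) → Fin n → ℝ}
    (hL : Measurable L) (hU : Measurable U) (w : ℝ) :
    MeasurableSet {y | width n L U y ≤ w} :=
  measurableSet_le (Measurable.iSup fun i => by fun_prop) measurable_const

lemma sub_le_width {n : ℕ} (L U : (Fin n → ℝ) → Fin n → ℝ) (y : Fin n → ℝ) (i : Fin n) :
    U y i - L y i ≤ width n L U y :=
  le_ciSup (f := fun i => U y i - L y i) (Set.finite_range _).bddAbove i

lemma norm2_div_norm2_single {n : ℕ} (hn : 1 ≤ n) (v : Fin n → ℝ) (i : Fin n) :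
    norm2 n v / norm2 n (Pi.single i 1) = √(∑ j, v j ^ 2) := by
  have hn' : (0 : ℝ) < n := by exact_mod_cast hn
  have h1 : ∑ j, (Pi.single i 1 : Fin n → ℝ) j ^ 2 = 1 := by
    simp [Pi.single_apply]
  rw [norm2, norm2, h1, ← Real.sqrt_div' _ (by positivity)]
  congr 1
  field_simp

lemma IsOrthProjOn.sum_mul_eq {n : ℕ} (hn : 1 ≤ n) {F : Submodule ℝ (Fin n → ℝ)}
    {P : (Fin n → ℝ) →ₗ[ℝ] (Fin n → ℝ)} (hP : IsOrthProjOn n F P)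
    {g : Fin n → ℝ} (hg : g ∈ F) (i : Fin n) :
    ∑ j, P (Pi.single i 1) j * g j = g i := by
  have hn' : (n : ℝ) ≠ 0 := by positivity
  have h := hP.2 (Pi.single i 1) g hg
  rw [inner2, div_eq_zero_iff, or_iff_left hn'] at h
  simp only [Pi.sub_apply, sub_mul, Finset.sum_sub_distrib] at h
  have h1 : ∑ j, (Pi.single i 1 : Fin n → ℝ) j * g j = g i := by simp [Pi.single_apply]
  linarith

lemma OmegaF_pos {n : ℕ} (hn : 1 ≤ n) {F : Submodule ℝ (Fin n → ℝ)} (hF : F ≠ ⊥)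
    {P : (Fin n → ℝ) →ₗ[ℝ] (Fin n → ℝ)} (hP : IsOrthProjOn n F P) : 0 < OmegaF n P := by
  obtain ⟨f, hf, hf0⟩ := F.ne_bot_iff.1 hF
  obtain ⟨i, hi⟩ := Function.ne_iff.1 hf0
  refine lt_of_lt_of_le ?_ (le_ciSup (f := fun i : Fin n =>
    norm2 n (P (Pi.single i 1)) / norm2 n (Pi.single i 1)) (Set.finite_range _).bddAbove i)
  simp only [norm2_div_norm2_single hn]
  refine Real.sqrt_pos.2 (lt_of_le_of_ne (Finset.sum_nonneg fun j _ => sq_nonneg _) fun h0 => hi ?_)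
  have hz := (Finset.sum_eq_zero_iff_of_nonneg fun j _ => sq_nonneg _).1 h0.symm
  rw [Pi.zero_apply, ← hP.sum_mul_eq hn hf i]
  exact Finset.sum_eq_zero fun j hj => by rw [pow_eq_zero_iff two_ne_zero |>.1 (hz j hj), zero_mul]

lemma exists_mem_apply_eq_sum_sq_eq {n : ℕ} (hn : 1 ≤ n) {F : Submodule ℝ (Fin n → ℝ)}
    (hF : F ≠ ⊥) {P : (Fin n → ℝ) →ₗ[ℝ] (Fin n → ℝ)} (hP : IsOrthProjOn n F P) (s : ℝ) :
    ∃ g ∈ F, ∃ i, g i = s ∧ ∑ j, g j ^ 2 = (s / OmegaF n P) ^ 2 := by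
  have hΩ := OmegaF_pos hn hF hP
  have : Nonempty (Fin n) := ⟨⟨0, hn⟩⟩
  obtain ⟨i, hi⟩ := exists_eq_ciSup_of_finite (f := fun i : Fin n =>
    norm2 n (P (Pi.single i 1)) / norm2 n (Pi.single i 1))
  change _ = OmegaF n P at hi
  rw [norm2_div_norm2_single hn] at hi
  set v := P (Pi.single i 1) with hv
  have hsum : ∑ j, v j ^ 2 = OmegaF n P ^ 2 := by
    rw [← hi, Real.sq_sqrt (Finset.sum_nonneg fun j _ => sq_nonneg _)]
  have hvi : v i = OmegaF n P ^ 2 := by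
    rw [← hsum, hv, ← hP.sum_mul_eq hn (hP.1 (Pi.single i 1)) i]
    exact Finset.sum_congr rfl fun j _ => (pow_two _).symm
  refine ⟨(s / OmegaF n P ^ 2) • v, F.smul_mem _ (hP.1 _), i, ?_, ?_⟩
  · rw [Pi.smul_apply, smul_eq_mul, hvi]
    field_simp
  · simp only [Pi.smul_apply, smul_eq_mul, mul_pow, ← Finset.mul_sum, hsum]
    field_simp

/-- Two-point testing bound: if a target in `F` differs from `0` by more than `w` in one
coordinate, no band of width at most `w` covers both it and `0`. -/
lemma le_tau_of_lt_apply {n : ℕ} {σ : ℝ} (hσ : 0 < σ) {α γ : ℝ}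
    {L U : (Fin n → ℝ) → Fin n → ℝ} (hL : Measurable L) (hU : Measurable U)
    {w : ℝ} (hw : 0 ≤ w) {g : Fin n → ℝ} {i : Fin n} (hgi : w < g i)
    (hcov0 : ENNReal.ofReal (1 - α) ≤ gaussP n 0 σ {y | covers n L U 0 y})
    (hcovg : ENNReal.ofReal (1 - α) ≤ gaussP n g σ {y | covers n L U g y})
    (hwidth : ENNReal.ofReal (1 - γ) ≤ gaussP n 0 σ {y | width n L U y ≤ w}) :
    1 - 2 * α - γ ≤ tau (√(∑ j, g j ^ 2) / σ) := by
  set C₀ := {y | covers n L U 0 y}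
  set C := {y | covers n L U g y}
  set V := {y | width n L U y ≤ w}
  have hC₀ : MeasurableSet C₀ := measurableSet_covers hL hU 0
  have hC : MeasurableSet C := measurableSet_covers hL hU g
  have hV : MeasurableSet V := measurableSet_width_le hL hU w
  have hdisj : Disjoint (C₀ ∩ V) C := Set.disjoint_left.2 fun y hy hyC => by
    have h1 := (hy.1 i).1
    have h2 : width n L U y ≤ w := hy.2
    have h3 := (hyC i).2
    have h4 := sub_le_width L U y i
    rw [Pi.zero_apply] at h1
    linarith
  have hg : 0 < ∑ j, g j ^ 2 :=
    Finset.sum_pos' (fun j _ => sq_nonneg _) ⟨i, Finset.mem_univ i, pow_pos (hw.trans_lt hgi) 2⟩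
  have key := gaussP_real_sub_le_tau n g hσ hg (hC₀.inter hV)
  have r0 := (ENNReal.ofReal_le_iff_le_toReal (by finiteness)).1 hcov0
  have rg := (ENNReal.ofReal_le_iff_le_toReal (by finiteness)).1 hcovg
  have rwidth := (ENNReal.ofReal_le_iff_le_toReal (by finiteness)).1 hwidth
  simp only [← measureReal_def] at r0 rg rwidth
  have hunion := measureReal_union (μ := gaussP n g σ) hdisj hC
  have hle1 : (gaussP n g σ).real (C₀ ∩ V ∪ C) ≤ 1 := measureReal_le_one
  have hie := measureReal_union_add_inter (μ := gaussP n 0 σ) (s := C₀) hV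
  have hle1' : (gaussP n 0 σ).real (C₀ ∪ V) ≤ 1 := measureReal_le_one
  linarith

/-- a `1−α` uniform band over a nonzero subspace `F` whose width is
at most `w` with `F`-uniform probability `1−γ` must satisfy
`w ≥ σ·Ω_F·τ⁻¹(1−2α−γ)`, equivalently `τ(w/(σ·Ω_F)) ≥ 1−2α−γ`. -/
theorem subspace_target_width (n : ℕ) (hn : 1 ≤ n) (σ : ℝ) (hσ : 0 < σ)
    (F : Submodule ℝ (Fin n → ℝ)) (hF : F ≠ ⊥)
    (P : (Fin n → ℝ) →ₗ[ℝ] (Fin n → ℝ)) (hP : IsOrthProjOn n F P)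
    (α γ : ℝ) (hα : 0 < α) (hα2 : α < 1 / 2) (hγ : 0 < γ) (hγ2 : γ < 1 - 2 * α)
    (L U : (Fin n → ℝ) → Fin n → ℝ)
    (hL : Measurable L) (hU : Measurable U) (hLU : ∀ y i, L y i ≤ U y i)
    (hcov : ∀ f ∈ F, ENNReal.ofReal (1 - α) ≤ gaussP n f σ {y | covers n L U f y})
    (w : ℝ) (hw : 0 ≤ w)
    (hwidth : ∀ f ∈ F,
      ENNReal.ofReal (1 - γ) ≤ gaussP n f σ {y | width n L U y ≤ w}) :
    σ * OmegaF n P * tauInv (1 - 2 * α - γ) ≤ w ∧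
    1 - 2 * α - γ ≤ tau (w / (σ * OmegaF n P)) := by
  have hΩ := OmegaF_pos hn hF hP
  have hσΩ : 0 < σ * OmegaF n P := mul_pos hσ hΩ
  have htau : ∀ s > w, 1 - 2 * α - γ ≤ tau (s / (σ * OmegaF n P)) := fun s hs => by
    obtain ⟨g, hgF, i, hgi, hg⟩ := exists_mem_apply_eq_sum_sq_eq hn hF hP s
    have h := le_tau_of_lt_apply hσ hL hU hw (hgi ▸ hs) (hcov 0 F.zero_mem) (hcov g hgF)
      (hwidth 0 F.zero_mem)
    rwa [hg, Real.sqrt_sq (div_nonneg (hw.trans hs.le) hΩ.le), div_div, mul_comm (OmegaF n P)] at h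
  have hlim : 1 - 2 * α - γ ≤ tau (w / (σ * OmegaF n P)) :=
    ge_of_tendsto
      (((tau_continuous.comp (continuous_id.div_const _)).tendsto w).mono_left
        (nhdsWithin_le_nhds (s := Set.Ioi w)))
      (Filter.eventually_of_mem self_mem_nhdsWithin htau)
  refine ⟨?_, hlim⟩
  have hinv := tau_tauInv (by linarith) (div_nonneg hw hσΩ.le) hlim
  rw [mul_comm, ← le_div_iff₀ hσΩ]
  exact tau_strictMono.le_iff_le.1 (hinv.trans_le hlim)

end
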